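/- For every positive integer n, Margenstern's Turing machine M2 never halts when started from the initial configuration ωb (A 1) 1^{n−1} bω: the computation never reaches an undefined transition. -/

import Mathlib

namespace Collatz

/-- The 3x+1 function. -/
def T (x : ℕ) : ℕ := if x % 2 = 0 then x / 2 else (3 * x + 1) / 2

/-- The 3x+1 conjecture: iterating `T` from any positive integer
eventually reaches the loop `2 ↦ 1 ↦ 2`. -/
def CollatzConjecture : Prop :=
  ∀ x : ℕ, 0 < x → ∃ k : ℕ, T^[k] x = 2 ∧ T^[k + 1] x = 1

inductive St | A | B
  deriving DecidableEq

inductive Sym | sb | s1 | sx | sr | su | sv | sy | sz | st | sk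
  deriving DecidableEq

open St Sym

/-- Transition table of Margenstern's Turing machine `M2`
(`true` = move right, `false` = move left); `delta A sk` is undefined. -/
def delta : St → Sym → Option (Sym × Bool × St)
  | A, sb => some (sb, true, A)
  | A, s1 => some (sx, true, B)
  | A, sx => some (s1, false, A)
  | A, sr => some (sk, true, B)
  | A, su => some (sx, true, A)
  | A, sv => some (sx, true, A)
  | A, sy => some (sr, false, A)
  | A, sz => some (sr, false, A)
  | A, st => some (sy, true, A)
  | A, sk => none
  | B, sb => some (sz, false, B)
  | B, s1 => some (su, true, B)
  | B, sx => some (sx, true, B)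
  | B, sr => some (sy, true, B)
  | B, su => some (sv, false, B)
  | B, sv => some (su, true, A)
  | B, sy => some (st, false, B)
  | B, sz => some (s1, false, A)
  | B, st => some (sx, true, B)
  | B, sk => some (sb, true, B)

structure Cfg where
  state : St
  head : ℤ
  tape : ℤ → Sym

/-- One step of the machine; `none` when the transition is undefined
(in particular in the halting state, which has no transitions).
In `delta`, the `Bool` component is the direction: `true` = right, `false` = left. -/
def step (c : Cfg) : Option Cfg :=
  (delta c.state (c.tape c.head)).map fun t =>
    ⟨t.2.2, c.head + (if t.2.1 then 1 else -1), Function.update c.tape c.head t.1⟩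

/-- `steps n c` is the configuration after `n` steps from `c`
(`none` if the machine has halted meanwhile). -/
def steps : ℕ → Cfg → Option Cfg
  | 0, c => some c
  | n + 1, c => (step c).bind (steps n)

/-- The tape holding the word `w` at positions `0, …, w.length - 1`,
and the blank symbol everywhere else. -/
def tapeOf (w : List Sym) : ℤ → Sym :=
  fun i => if 0 ≤ i then w.getD i.toNat sb else sb

/-- `c` is the configuration `ωb u (q s) v bω`, where `w = u ++ s :: v` and
`pos = u.length` (i.e. the tape holds exactly the word `w` surrounded by blanks,
the machine is in state `q`, and the head scans the symbol of `w` at index `pos`). -/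
def IsConfig (c : Cfg) (q : St) (w : List Sym) (pos : ℕ) : Prop :=
  c.state = q ∧ ∃ d : ℤ, c.head = d + pos ∧ c.tape = fun i => tapeOf w (i - d)

/-- The machine eventually reaches the configuration `ωb u (q s) v bω`. -/
def Reaches (c : Cfg) (q : St) (w : List Sym) (pos : ℕ) : Prop :=
  ∃ t : ℕ, ∃ c' : Cfg, steps t c = some c' ∧ IsConfig c' q w pos

/-- The machine halts when started from configuration `c`. -/
def Halts (c : Cfg) : Prop := ∃ n : ℕ, steps n c = none

/-- Initial configuration: word `w` on the tape, head on its leftmost symbol, state `A`. -/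
def initCfg (w : List Sym) : Cfg := ⟨St.A, 0, tapeOf w⟩

/-- States of the automaton describing the tape to the left of the head. -/
inductive LS | top | b | x | u | y | k | ky | m | my
  deriving DecidableEq

/-- States of the automaton describing the tape to the right of the head. -/
inductive RS | e | r | o | z | t | v
  deriving DecidableEq

def allL : List LS := [.top, .b, .x, .u, .y, .k, .ky, .m, .my]
def allR : List RS := [.e, .r, .o, .z, .t, .v]
def allS : List Sym := [sb, s1, sx, sr, su, sv, sy, sz, st, sk]

theorem mem_allL (l : LS) : l ∈ allL := by cases l <;> decide
theorem mem_allR (l : RS) : l ∈ allR := by cases l <;> decide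
theorem mem_allS (l : Sym) : l ∈ allS := by cases l <;> decide

/-- Left automaton: reading the symbol after a prefix. -/
def lt : LS → Sym → LS → Bool
  | _, sb, .b => true
  | .b, sx, .x | .x, sx, .x => true
  | .x, su, .u | .u, su, .u => true
  | .x, sy, .y | .u, sy, .y | .y, sy, .y => true
  | .x, sk, .k => true
  | .k, sy, .ky | .ky, sy, .ky => true
  | .x, su, .m | .m, sx, .m => true
  | .m, sy, .my | .my, sy, .my => true
  | _, _, _ => false

/-- Right automaton: reading the symbol before a suffix. -/
def rt : RS → Sym → RS → Bool
  | .e, sb, .e => true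
  | .e, sr, .r | .r, sr, .r => true
  | .e, s1, .o | .r, s1, .o | .o, s1, .o => true
  | .e, sz, .z => true
  | .z, st, .t | .t, st, .t => true
  | .z, sv, .v | .t, sv, .v | .v, sv, .v => true
  | _, _, _ => false

/-- The invariant. -/
def inv : St → LS → Sym → RS → Bool
  | B, l, s1, r => (l ∈ [LS.x, .u]) && (r ∈ [RS.e, .r, .o])
  | B, l, sr, r => (l ∈ [LS.x, .u, .y, .k, .ky]) && (r ∈ [RS.e, .r])
  | B, l, sb, r => (l ∈ [LS.x, .u, .y, .k, .ky]) && (r ∈ [RS.e])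
  | B, l, su, r => (l ∈ [LS.x, .u]) && (r ∈ [RS.z, .t, .v])
  | B, l, sx, r => (l ∈ [LS.b, .x]) && (r ∈ [RS.z, .t, .v])
  | B, l, sy, r => (l ∈ [LS.x, .u, .y, .k, .ky]) && (r ∈ [RS.z, .t])
  | B, l, sk, r => (l ∈ [LS.x]) && (r ∈ [RS.z, .t])
  | B, l, sz, r => (l ∈ [LS.b, .x]) && (r ∈ [RS.e])
  | B, l, st, r => (l ∈ [LS.b, .x]) && (r ∈ [RS.z, .t])
  | B, l, sv, r => (l ∈ [LS.x]) && (r ∈ [RS.z, .t, .v])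
  | A, l, sv, r => (l ∈ [LS.m]) && (r ∈ [RS.z, .t, .v])
  | A, l, st, r => (l ∈ [LS.m, .my]) && (r ∈ [RS.z, .t])
  | A, l, sz, r => (l ∈ [LS.m, .my]) && (r ∈ [RS.e])
  | A, l, sx, r => ((l ∈ [LS.m]) && (r ∈ [RS.r, .o])) || ((l ∈ [LS.b, .x]) && (r ∈ [RS.o]))
  | A, l, sy, r => (l ∈ [LS.m, .my]) && (r ∈ [RS.r])
  | A, l, su, r => (l ∈ [LS.x]) && (r ∈ [RS.r, .o])
  | A, l, s1, r => (l ∈ [LS.b, .x]) && (r ∈ [RS.e, .r, .o])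
  | A, l, sr, r => (l ∈ [LS.x]) && (r ∈ [RS.e, .r])
  | A, _, sb, r => (r ∈ [RS.o])
  | A, _, sk, _ => false

/-- One-step closure check at an abstract configuration. -/
def closedAt (q : St) (l : LS) (s : Sym) (r : RS) : Bool :=
  match delta q s with
  | none => false
  | some (w, true, p) => allL.any fun l' => lt l w l' &&
      allS.all fun s' => allR.all fun r' => !rt r' s' r || inv p l' s' r'
  | some (w, false, p) => l ≠ .top && allR.any fun r' => rt r w r' &&
      allS.all fun s' => allL.all fun l' => !lt l' s' l || inv p l' s' r'

theorem closed : ∀ (q : St) (l : LS) (s : Sym) (r : RS),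
    inv q l s r = true → closedAt q l s r = true := by
  intro q l s r
  cases q <;> cases s <;> cases l <;> cases r <;> decide

/-- `L l t h`: the tape strictly left of `h` is described by `l`. -/
inductive L : LS → (ℤ → Sym) → ℤ → Prop
  | top (t h) : L .top t h
  | push {l l' t h hh s} : L l t h → t h = s → lt l s l' = true → hh = h + 1 → L l' t hh

/-- `R r t h`: the tape at and right of `h` is described by `r`. -/
inductive R : RS → (ℤ → Sym) → ℤ → Prop
  | nil {t h} : (∀ i, h ≤ i → t i = sb) → R .e t h
  | push {r r' t h h' s} : R r t h → t h' = s → rt r s r' = true → h = h' + 1 → R r' t h'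

theorem L.frame {l t h} (H : L l t h) {t' : ℤ → Sym} (ht : ∀ i, i < h → t' i = t i) :
    L l t' h := by
  induction H with
  | top => exact .top _ _
  | push _ h1 h2 h3 ih =>
    subst h3
    exact .push (ih fun i hi => ht i (by omega)) ((ht _ (by omega)).trans h1) h2 rfl

theorem R.frame {r t h} (H : R r t h) {t' : ℤ → Sym} (ht : ∀ i, h ≤ i → t' i = t i) :
    R r t' h := by
  induction H with
  | nil hb => exact .nil fun i hi => (ht i hi).trans (hb i hi)
  | push _ h1 h2 h3 ih =>
    subst h3
    exact .push (ih fun i hi => ht i (by omega)) ((ht _ (by omega)).trans h1) h2 rfl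

theorem L.pop {l t h} (H : L l t h) (hl : l ≠ .top) :
    ∃ l', L l' t (h - 1) ∧ lt l' (t (h - 1)) l = true := by
  cases H with
  | top => exact absurd rfl hl
  | push h0 h1 h2 h3 =>
    subst h3 h1
    exact ⟨_, by simpa using h0, by simpa using h2⟩

theorem R.pop {r t h} (H : R r t h) : ∃ r', R r' t (h + 1) ∧ rt r' (t h) r = true := by
  cases H with
  | nil hb => exact ⟨.e, .nil fun i hi => hb i (by omega), by rw [hb _ le_rfl]; rfl⟩
  | push h0 h1 h2 h3 =>
    subst h3 h1
    exact ⟨_, h0, h2⟩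

def Good (c : Cfg) : Prop :=
  ∃ l r, L l c.tape c.head ∧ R r c.tape (c.head + 1) ∧
    inv c.state l (c.tape c.head) r = true

theorem Good.step {c : Cfg} (H : Good c) : ∃ c', step c = some c' ∧ Good c' := by
  obtain ⟨q, h, t⟩ := c
  obtain ⟨l, r, hL, hR, hI⟩ := H
  have hc := closed _ _ _ _ hI
  simp only at hL hR hc
  unfold closedAt at hc
  unfold Collatz.step
  simp only
  rcases hd : delta q (t h) with _ | ⟨w, d, p⟩
  · simp [hd] at hc
  refine ⟨_, rfl, ?_⟩
  change Good ⟨p, h + (if d = true then 1 else -1), Function.update t h w⟩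
  have hL' : L l (Function.update t h w) h :=
    hL.frame fun i hi => Function.update_of_ne (by omega) _ _
  have hR' : R r (Function.update t h w) (h + 1) :=
    hR.frame fun i hi => Function.update_of_ne (by omega) _ _
  have hw : Function.update t h w h = w := Function.update_self _ _ _
  rw [hd] at hc
  generalize Function.update t h w = t' at *
  cases d
  · simp only [Bool.and_eq_true, List.any_eq_true, List.all_eq_true, decide_eq_true_eq] at hc
    obtain ⟨hl, r', -, hr', hall⟩ := hc
    obtain ⟨l', hl', hlt⟩ := hL'.pop hl
    have := hall _ (mem_allS (t' (h - 1))) _ (mem_allL l')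
    rw [hlt] at this
    change Good ⟨p, h + -1, t'⟩
    have e : h + -1 + 1 = h := by omega
    refine ⟨l', r', hl', ?_, this⟩
    change R r' t' (h + -1 + 1)
    rw [e]
    exact .push hR' hw hr' rfl
  · simp only [Bool.and_eq_true, List.any_eq_true, List.all_eq_true] at hc
    obtain ⟨l', -, hl', hall⟩ := hc
    obtain ⟨r', hr', hrt⟩ := hR'.pop
    have := hall _ (mem_allS (t' (h + 1))) _ (mem_allR r')
    rw [hrt] at this
    exact ⟨l', r', .push hL' hw hl' rfl, hr', this⟩

theorem Good.steps (t : ℕ) : ∀ {c : Cfg}, Good c → Collatz.steps t c ≠ none := by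
  induction t with
  | zero => intro c _; simp [Collatz.steps]
  | succ t ih =>
    intro c H
    obtain ⟨c', h1, h2⟩ := H.step
    simp only [Collatz.steps, h1, Option.bind_some]
    exact ih h2

theorem tape_ones (n : ℕ) (i : ℤ) :
    tapeOf (List.replicate n s1) i = if 0 ≤ i ∧ i < n then s1 else sb := by
  unfold tapeOf
  by_cases h0 : 0 ≤ i
  · by_cases h1 : i < n
    · have : i.toNat < n := by omega
      simp [h0, h1, this, List.getD_eq_getElem?_getD, List.getElem?_replicate]
    · have : ¬ i.toNat < n := by omega
      simp [h0, h1, this, List.getD_eq_getElem?_getD, List.getElem?_replicate]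
  · simp [h0]

theorem R_ones (n : ℕ) (j : ℕ) (hj : j < n) :
    ∃ r, (r = RS.e ∨ r = .o) ∧ R r (tapeOf (List.replicate n s1)) ((n : ℤ) - j) := by
  induction j with
  | zero =>
    exact ⟨.e, .inl rfl, .nil fun i hi => by
      rw [tape_ones, if_neg (by push_cast at hi; omega)]⟩
  | succ j ih =>
    obtain ⟨r, hr, H⟩ := ih (by omega)
    refine ⟨.o, .inr rfl, .push H (s := s1) ?_ (by rcases hr with rfl | rfl <;> rfl)
      (by push_cast; ring)⟩
    rw [tape_ones, if_pos (by push_cast; omega)]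

/-- For every positive integer `n`, Margenstern's machine `M2` never halts when
started from `ωb (A 1) 1^{n-1} bω`: it never reaches an undefined transition. -/
theorem M2_never_halts (n : ℕ) (hn : 0 < n) :
    ∀ t : ℕ, steps t (initCfg (List.replicate n s1)) ≠ none := by
  intro t
  apply Good.steps
  obtain ⟨r, hr, H⟩ := R_ones n (n - 1) (by omega)
  refine ⟨.b, r, .push (.top _ (-1)) (s := sb) ?_ rfl rfl, ?_, ?_⟩
  · simp only [initCfg]
    rw [tape_ones, if_neg (by omega)]
  · simp only [initCfg]
    convert H using 1
    omega
  · simp only [initCfg]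
    rw [tape_ones, if_pos (by omega)]
    rcases hr with rfl | rfl <;> decide

end Collatz
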